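/- arXiv:2206.13319 — 2 statements merged into one kernel-verified Lean document; each statement's English description precedes it below -/
import Mathlib

section
/- For every real k > 0 and every real x, one has 0 ≤ |x| − x·tanh(k·x) ≤ 1/k; in particular the smoothed function x ↦ 1/k + x·tanh(k·x) is an over-approximation of the absolute value, i.e. |x| ≤ 1/k + x·tanh(k·x) for all x ∈ ℝ. -/
theorem Real.mul_one_sub_tanh_le_one {t : ℝ} (ht : 0 ≤ t) : t * (1 - Real.tanh t) ≤ 1 := by
  have hE := Real.exp_pos t
  have hF := Real.exp_pos (-t)
  have hEF : Real.exp t * Real.exp (-t) = 1 := by rw [← Real.exp_add]; simp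
  have hlin := Real.add_one_le_exp t
  have heq : t * (1 - Real.tanh t) =
      2 * t * Real.exp (-t) / (Real.exp t + Real.exp (-t)) := by
    rw [Real.tanh_eq]
    field_simp
    ring
  rw [heq, div_le_one (by positivity)]
  nlinarith [mul_le_mul_of_nonneg_right hlin hF.le]

theorem Real.mul_tanh_mul_abs (k x : ℝ) : |x| * Real.tanh (k * |x|) = x * Real.tanh (k * x) := by
  rcases abs_choice x with h | h <;> simp [h, Real.tanh_neg]

/-- The smoothed absolute value: for `k > 0`, `x · tanh(k·x)` underestimates `|x|`
by at most `1/k`; hence `1/k + x·tanh(k·x)` over-approximates `|x|`. -/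
theorem smooth_abs_bounds (k : ℝ) (hk : 0 < k) (x : ℝ) :
    0 ≤ |x| - x * Real.tanh (k * x) ∧
    |x| - x * Real.tanh (k * x) ≤ 1 / k ∧
    |x| ≤ 1 / k + x * Real.tanh (k * x) := by
  rw [← Real.mul_tanh_mul_abs]
  have hx := abs_nonneg x
  have hupper : |x| - |x| * Real.tanh (k * |x|) ≤ 1 / k := by
    rw [le_div_iff₀ hk]
    linarith [Real.mul_one_sub_tanh_le_one (mul_nonneg hk.le hx)]
  refine ⟨?_, hupper, by linarith⟩
  nlinarith [Real.tanh_lt_one (k * |x|)]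
end

section
/- Let n ≥ 1, p ∈ Δ_n, z ∈ ℝ^n and α ∈ (0, 1]. If AVaR_α^p(z) ≤ 0, then P_p(z > 0) ≤ α. In other words, the average value-at-risk constraint is a safe (conservative) surrogate for the chance constraint. -/
/-- The average value-at-risk constraint is a safe surrogate for the chance constraint:
if `AVaR_α^p(z) ≤ 0` then `P_p(z > 0) ≤ α`. -/
theorem avar_le_zero_implies_chance_constraint {n : ℕ} (hn : 1 ≤ n)
    (p z : Fin n → ℝ) (α : ℝ)
    (hp : ∀ i, 0 ≤ p i) (hp1 : ∑ i, p i = 1) (hα : α ∈ Set.Ioc (0 : ℝ) 1)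
    (havar : (⨅ s : ℝ, (s + (1 / α) * ∑ i, p i * max (z i - s) 0)) ≤ 0) :
    ∑ i ∈ Finset.univ.filter (fun i => 0 < z i), p i ≤ α := by
  obtain ⟨hα0, -⟩ := hα
  by_contra! hlt
  have hne : (Finset.univ.filter (fun i => 0 < z i)).Nonempty := by
    rw [Finset.nonempty_iff_ne_empty]
    intro h
    rw [h, Finset.sum_empty] at hlt
    exact absurd hlt hα0.not_gt
  obtain ⟨j, hj, hmin⟩ := Finset.exists_min_image _ z hne
  have hzj : 0 < z j := (Finset.mem_filter.mp hj).2
  refine absurd (hzj.trans_le (le_ciInf fun s => ?_)) havar.not_gt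
  have hnonneg : ∀ i, 0 ≤ p i * max (z i - s) 0 := fun i =>
    mul_nonneg (hp i) (le_max_right _ _)
  rcases le_total (z j) s with hs | hs
  · exact le_add_of_le_of_nonneg hs
      (mul_nonneg (one_div_pos.mpr hα0).le (Finset.sum_nonneg fun i _ => hnonneg i))
  · have hsum : α * (z j - s) ≤ ∑ i, p i * max (z i - s) 0 := calc
      α * (z j - s) ≤ (∑ i ∈ Finset.univ.filter (fun i => 0 < z i), p i) * (z j - s) :=
        mul_le_mul_of_nonneg_right hlt.le (sub_nonneg.mpr hs)
      _ = ∑ i ∈ Finset.univ.filter (fun i => 0 < z i), p i * (z j - s) := Finset.sum_mul ..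
      _ ≤ ∑ i ∈ Finset.univ.filter (fun i => 0 < z i), p i * max (z i - s) 0 :=
        Finset.sum_le_sum fun i hi => mul_le_mul_of_nonneg_left
          (le_max_of_le_left (sub_le_sub_right (hmin i hi) s)) (hp i)
      _ ≤ ∑ i, p i * max (z i - s) 0 :=
        Finset.sum_le_sum_of_subset_of_nonneg (Finset.filter_subset _ _) fun i _ _ => hnonneg i
    have h : z j - s ≤ (∑ i, p i * max (z i - s) 0) / α := by
      rwa [le_div_iff₀' hα0]
    rw [one_div_mul_eq_div]
    linarith
end
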